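/- arXiv:1607.01606 — 2 statements merged into one kernel-verified Lean document; each statement's English description precedes it below -/
import Mathlib

section
/- Let K₀ > 0 be a real number, let r be a real number with 0 < r < 1/√K₀, let t ∈ [0,1], and let h be a real number satisfying √K₀·(cos(√K₀·r)/sin(√K₀·r))·t ≤ h ≤ √K₀·(cosh(√K₀·r)/sinh(√K₀·r))·t. Then |h − t/r| ≤ √K₀. -/
/-- The cotangent is at least `1 / x - 1` on `(0, 1]`. -/
theorem inv_sub_one_le_cos_div_sin {x : ℝ} (hx : 0 < x) (hx1 : x ≤ 1) :
    1 / x - 1 ≤ Real.cos x / Real.sin x := by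
  have hs : 0 < Real.sin x := Real.sin_pos_of_pos_of_le_one hx hx1
  have hsx : Real.sin x ≤ x := (Real.sin_lt hx).le
  have hc : 1 - x ^ 2 / 2 ≤ Real.cos x := Real.one_sub_sq_div_two_le_cos
  have hcx : 1 - x ≤ Real.cos x := by nlinarith
  have key : (1 - x) * Real.sin x ≤ Real.cos x * x := by
    calc (1 - x) * Real.sin x ≤ (1 - x) * x :=
          mul_le_mul_of_nonneg_left hsx (sub_nonneg.2 hx1)
      _ ≤ Real.cos x * x := mul_le_mul_of_nonneg_right hcx hx.le
  have heq : 1 / x - 1 = (1 - x) / x := by field_simp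
  rw [heq, div_le_div_iff₀ hx hs]
  exact key

/-- The hyperbolic cotangent is at most `1 / x + 1` for positive `x`. -/
theorem cosh_div_sinh_le_inv_add_one {x : ℝ} (hx : 0 < x) :
    Real.cosh x / Real.sinh x ≤ 1 / x + 1 := by
  have hs : 0 < Real.sinh x := Real.sinh_pos_iff.2 hx
  have hsx : x ≤ Real.sinh x := Real.self_le_sinh_iff.2 hx.le
  have he : Real.cosh x - Real.sinh x ≤ 1 := by
    rw [Real.cosh_sub_sinh]
    exact Real.exp_le_one_iff.2 (by linarith)
  have heq : 1 / x + 1 = (1 + x) / x := by field_simp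
  rw [heq, div_le_div_iff₀ hs hx]
  nlinarith [mul_le_mul_of_nonneg_left he hx.le]


/-- Scalar core of the Hessian comparison estimate: if `K₀ > 0`, `0 < r < 1/√K₀`,
`t ∈ [0,1]`, and `√K₀·cot(√K₀ r)·t ≤ h ≤ √K₀·coth(√K₀ r)·t`, then `|h − t/r| ≤ √K₀`. -/
theorem stmt_2 (K₀ r t h : ℝ) (hK : 0 < K₀) (hr : 0 < r) (hr' : r < 1 / Real.sqrt K₀)
    (ht0 : 0 ≤ t) (ht1 : t ≤ 1)
    (hlow : Real.sqrt K₀ * (Real.cos (Real.sqrt K₀ * r) / Real.sin (Real.sqrt K₀ * r)) * t ≤ h)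
    (hhigh : h ≤ Real.sqrt K₀ * (Real.cosh (Real.sqrt K₀ * r) / Real.sinh (Real.sqrt K₀ * r)) * t) :
    |h - t / r| ≤ Real.sqrt K₀ := by
  have hs : 0 < Real.sqrt K₀ := Real.sqrt_pos.2 hK
  set s := Real.sqrt K₀
  have hx : 0 < s * r := mul_pos hs hr
  have hx1 : s * r ≤ 1 := by
    rw [mul_comm]
    exact ((lt_div_iff₀ hs).1 hr').le
  have hst : s * t ≤ s := mul_le_of_le_one_right hs.le ht1
  have hst0 : 0 ≤ s * t := mul_nonneg hs.le ht0
  have hdiv : t / r = s * t * (1 / (s * r)) := by field_simp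
  have hcot := mul_le_mul_of_nonneg_left (inv_sub_one_le_cos_div_sin hx hx1) hst0
  have hcoth := mul_le_mul_of_nonneg_left (cosh_div_sinh_le_inv_add_one hx) hst0
  rw [hdiv, abs_le]
  constructor <;> linarith
end

section
/- Let a > 0 and C ≥ 1 be real numbers, let 0 < R ≤ 1, and set ε_k = 1/(2^{k+1}·a + 1) and A = Π_{k=0}^{∞}(1+ε_k) (a finite real number ≥ 1). Let (x_k)_{k≥0} be a sequence of positive reals with x_0 ≥ 1 satisfying, for every k ≥ 0, x_{k+1} ≤ (2·C·4^{k}·(2^{k+1}·a+1)·R^{−2})^{ε_k/2} · x_k^{1+ε_k}. Then there exists a constant C′ > 0 depending only on C and a (and not on R, on (x_k), or on k) such that for every k ≥ 0, x_k ≤ C′ · R^{−A/a} · x_0^{A}. -/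
open Finset in
/-- Discrete Grönwall inequality with multiplicative weights `1 + ε k`. -/
theorem le_prod_one_add_mul_of_le {ε c y : ℕ → ℝ} (hε : ∀ k, 0 ≤ ε k) (hc : ∀ k, 0 ≤ c k)
    (hy : ∀ k, y (k + 1) ≤ c k + (1 + ε k) * y k) (k : ℕ) :
    y k ≤ (∏ j ∈ range k, (1 + ε j)) * (y 0 + ∑ j ∈ range k, c j) := by
  induction k with
  | zero => simp
  | succ k ih =>
    have hP : 1 ≤ ∏ j ∈ range (k + 1), (1 + ε j) :=
      Finset.one_le_prod fun j _ => by linarith [hε j]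
    calc y (k + 1) ≤ c k + (1 + ε k) * y k := hy k
      _ ≤ (∏ j ∈ range (k + 1), (1 + ε j)) * c k +
          (1 + ε k) * ((∏ j ∈ range k, (1 + ε j)) * (y 0 + ∑ j ∈ range k, c j)) := by
        gcongr
        · exact le_mul_of_one_le_left (hc k) hP
        · linarith [hε k]
      _ = _ := by rw [prod_range_succ, sum_range_succ]; ring

theorem prod_range_one_add_le_tprod {ε : ℕ → ℝ} (hε : ∀ k, 0 ≤ ε k) (hs : Summable ε) (k : ℕ) :
    ∏ j ∈ Finset.range k, (1 + ε j) ≤ ∏' j, (1 + ε j) := by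
  refine Monotone.ge_of_tendsto (monotone_nat_of_le_succ fun n => ?_)
    (Real.multipliable_one_add_of_summable hs).hasProd.tendsto_prod_nat k
  rw [Finset.prod_range_succ]
  exact le_mul_of_one_le_right (Finset.prod_nonneg fun j _ => by linarith [hε j])
    (by linarith [hε n])

theorem one_div_two_pow_mul_add_one_le {a : ℝ} (ha : 0 < a) (k : ℕ) :
    1 / (2 ^ (k + 1) * a + 1) ≤ 1 / a / 2 / 2 ^ k := by
  rw [div_div, div_div]
  gcongr
  rw [pow_succ]
  linarith

theorem summable_one_div_two_pow_mul_add_one {a : ℝ} (ha : 0 < a) :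
    Summable fun k : ℕ => 1 / (2 ^ (k + 1) * a + 1) :=
  (summable_geometric_two' (1 / a)).of_nonneg_of_le (fun _ => by positivity)
    (one_div_two_pow_mul_add_one_le ha)

theorem sum_one_div_two_pow_mul_add_one_le {a : ℝ} (ha : 0 < a) (k : ℕ) :
    ∑ j ∈ Finset.range k, 1 / (2 ^ (j + 1) * a + 1) ≤ 1 / a :=
  ((summable_one_div_two_pow_mul_add_one ha).sum_le_tsum _ fun _ _ => by positivity).trans <|
    ((summable_one_div_two_pow_mul_add_one ha).tsum_le_tsum (one_div_two_pow_mul_add_one_le ha)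
      (summable_geometric_two' (1 / a))).trans_eq (tsum_geometric_two' (1 / a))

theorem one_le_moser_coeff {a C : ℝ} (ha : 0 < a) (hC : 1 ≤ C) (k : ℕ) :
    1 ≤ 2 * C * 4 ^ k * (2 ^ (k + 1) * a + 1) := by
  have h4 : (1 : ℝ) ≤ 4 ^ k := one_le_pow₀ (by norm_num)
  have hp : (1 : ℝ) ≤ 2 ^ (k + 1) * a + 1 := le_add_of_nonneg_left (by positivity)
  exact one_le_mul_of_one_le_of_one_le
    (one_le_mul_of_one_le_of_one_le (by linarith) h4) hp

theorem log_moser_coeff_le {a C : ℝ} (ha : 0 < a) (hC : 1 ≤ C) (k : ℕ) :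
    Real.log (2 * C * 4 ^ k * (2 ^ (k + 1) * a + 1)) ≤
      Real.log (4 * C * (a + 1)) + k * Real.log 8 := by
  have h2 : (1 : ℝ) ≤ 2 ^ (k + 1) := one_le_pow₀ (by norm_num)
  have h8 : (8 : ℝ) ^ k = 4 ^ k * 2 ^ k := by rw [← mul_pow]; norm_num
  rw [← Real.log_pow, ← Real.log_mul (by positivity) (by positivity)]
  refine Real.log_le_log (by positivity) ?_
  calc 2 * C * 4 ^ k * (2 ^ (k + 1) * a + 1)
      ≤ 2 * C * 4 ^ k * (2 ^ (k + 1) * a + 2 ^ (k + 1)) := by gcongr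
    _ = 4 * C * (a + 1) * 8 ^ k := by rw [h8]; ring

theorem summable_log_moser_coeff {a C : ℝ} (ha : 0 < a) (hC : 1 ≤ C) :
    Summable fun k : ℕ => 1 / (2 ^ (k + 1) * a + 1) / 2 *
      Real.log (2 * C * 4 ^ k * (2 ^ (k + 1) * a + 1)) := by
  have hgeom : Summable fun k : ℕ => (k : ℝ) * (1 / 2 : ℝ) ^ k := by
    simpa using summable_pow_mul_geometric_of_norm_lt_one (R := ℝ) 1 (r := 1 / 2) (by norm_num)
  have hsum := ((summable_geometric_two.mul_left (Real.log (4 * C * (a + 1)))).add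
    (hgeom.mul_left (Real.log 8))).mul_left (1 / a / 2 / 2)
  refine hsum.of_nonneg_of_le
    (fun k => mul_nonneg (by positivity) (Real.log_nonneg (one_le_moser_coeff ha hC k)))
    fun k => ?_
  calc _ ≤ 1 / a / 2 / 2 ^ k / 2 * (Real.log (4 * C * (a + 1)) + k * Real.log 8) := by
        gcongr ?_ / 2 * ?_
        · exact Real.log_nonneg (one_le_moser_coeff ha hC k)
        · exact one_div_two_pow_mul_add_one_le ha k
        · exact log_moser_coeff_le ha hC k
    _ = _ := by rw [one_div_pow]; ring

/-- Quantitative Moser-iteration lemma: with `ε_k = 1/(2^{k+1}a+1)` and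
`A = Π_{k=0}^∞ (1+ε_k)`, if `0 < R ≤ 1`, `x_0 ≥ 1`, all `x_k > 0`, and
`x_{k+1} ≤ (2·C·4^k·(2^{k+1}a+1)·R^{-2})^{ε_k/2} · x_k^{1+ε_k}` for all `k`,
then there is `C' > 0` depending only on `C` and `a` such that
`x_k ≤ C' · R^{-A/a} · x_0^A` for all `k`. -/
theorem stmt_8 (a C : ℝ) (ha : 0 < a) (hC : 1 ≤ C) :
    ∃ C' > (0 : ℝ), ∀ R : ℝ, 0 < R → R ≤ 1 → ∀ x : ℕ → ℝ,
      (∀ k, 0 < x k) → 1 ≤ x 0 →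
      (∀ k : ℕ, x (k + 1) ≤
        (2 * C * 4 ^ k * (2 ^ (k + 1) * a + 1) * R ^ (-(2 : ℝ))) ^
            ((1 / (2 ^ (k + 1) * a + 1)) / 2) *
          x k ^ (1 + 1 / (2 ^ (k + 1) * a + 1))) →
      ∀ k : ℕ, x k ≤
        C' * R ^ (-((∏' j : ℕ, ((1 : ℝ) + 1 / (2 ^ (j + 1) * a + 1))) / a)) *
          x 0 ^ (∏' j : ℕ, ((1 : ℝ) + 1 / (2 ^ (j + 1) * a + 1))) := by
  set ε : ℕ → ℝ := fun k => 1 / (2 ^ (k + 1) * a + 1)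
  set D : ℕ → ℝ := fun k => 2 * C * 4 ^ k * (2 ^ (k + 1) * a + 1)
  set A : ℝ := ∏' j : ℕ, ((1 : ℝ) + 1 / (2 ^ (j + 1) * a + 1))
  set S : ℝ := ∑' k, ε k / 2 * Real.log (D k)
  have hε (k : ℕ) : 0 ≤ ε k := by positivity
  have hD (k : ℕ) : 1 ≤ D k := one_le_moser_coeff ha hC k
  have hterm (k : ℕ) : 0 ≤ ε k / 2 * Real.log (D k) :=
    mul_nonneg (by linarith [hε k]) (Real.log_nonneg (hD k))
  refine ⟨Real.exp (A * S), Real.exp_pos _, fun R hR hR1 x hx hx0 hstep k => ?_⟩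
  have hlogR : 0 ≤ -Real.log R := by linarith [Real.log_nonpos hR.le hR1]
  have hlogx : 0 ≤ Real.log (x 0) := Real.log_nonneg hx0
  have hlogstep (k : ℕ) : Real.log (x (k + 1)) ≤
      (ε k / 2 * Real.log (D k) + ε k * -Real.log R) + (1 + ε k) * Real.log (x k) := by
    have hDpos : 0 < D k := by linarith [hD k]
    have hRpos : 0 < R ^ (-(2 : ℝ)) := Real.rpow_pos_of_pos hR _
    have h := Real.log_le_log (hx (k + 1)) (hstep k)
    change _ ≤ Real.log ((D k * R ^ (-(2 : ℝ))) ^ (ε k / 2) * x k ^ (1 + ε k)) at h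
    rw [Real.log_mul (Real.rpow_pos_of_pos (mul_pos hDpos hRpos) _).ne'
        (Real.rpow_pos_of_pos (hx k) _).ne', Real.log_rpow (mul_pos hDpos hRpos),
      Real.log_rpow (hx k), Real.log_mul hDpos.ne' hRpos.ne', Real.log_rpow hR] at h
    linarith
  have hsum : ∑ j ∈ Finset.range k, (ε j / 2 * Real.log (D j) + ε j * -Real.log R) ≤
      S + 1 / a * -Real.log R := by
    rw [Finset.sum_add_distrib, ← Finset.sum_mul]
    gcongr
    · exact (summable_log_moser_coeff ha hC).sum_le_tsum _ fun j _ => hterm j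
    · exact sum_one_div_two_pow_mul_add_one_le ha k
  have hprod : ∏ j ∈ Finset.range k, (1 + ε j) ≤ A :=
    prod_range_one_add_le_tprod hε (summable_one_div_two_pow_mul_add_one ha) k
  have hA : 0 ≤ A := (Finset.prod_nonneg fun j _ => by linarith [hε j]).trans hprod
  have hmain : Real.log (x k) ≤ A * (Real.log (x 0) + (S + 1 / a * -Real.log R)) := by
    refine (le_prod_one_add_mul_of_le (y := fun k => Real.log (x k)) hε
      (fun j => add_nonneg (hterm j) (mul_nonneg (hε j) hlogR)) hlogstep k).trans ?_
    refine mul_le_mul hprod (by gcongr) ?_ hA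
    exact add_nonneg hlogx (Finset.sum_nonneg fun j _ =>
      add_nonneg (hterm j) (mul_nonneg (hε j) hlogR))
  rw [Real.rpow_def_of_pos hR, Real.rpow_def_of_pos (hx 0), ← Real.exp_add, ← Real.exp_add,
    ← Real.log_le_iff_le_exp (hx k)]
  exact hmain.trans_eq (by ring)
end
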